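/- Let K be a field of characteristic 0 with algebraic closure K̄. Let f ∈ K[x,y] be a squarefree (reduced) polynomial, written f = Σ_{i=0}^n f_i(x)·y^i with f_i ∈ K[x], n = deg_y f, and f₀ ≠ 0, f_n ≠ 0. Then the following are equivalent: (A) f is quasi-homogeneous with the weight of x nonzero, i.e. there exist integers w, α, β with α ≠ 0 such that α·i + β·j = w for every monomial x^i y^j appearing in f with nonzero coefficient; (B) f₀ and f_n are nonzero monomials in x, and for every a ∈ K̄ with a ≠ 0 the univariate polynomial f(a, y) ∈ K̄[y] has degree n and no repeated root in K̄. -/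

import Mathlib

open Polynomial

/-- A univariate polynomial over a field `K` is a nonzero monomial. -/
def IsNonzeroMonomial {K : Type*} [Field K] (p : Polynomial K) : Prop :=
  ∃ (c : K) (k : ℕ), c ≠ 0 ∧ p = C c * X ^ k

section
open WithZero

/-- A derivation `D` with bounded poles and `D x = x` at a zero `x` of `v` is logarithmic at `v`. -/
theorem Valuation.map_derivation_le {k L : Type*} [Field k] [CharZero k] [Field L] [Algebra k L]
    (v : Valuation L ℤᵐ⁰) (D : Derivation k L L)
    (hk : ∀ c : k, v (algebraMap k L c) ≤ 1)
    (hres : ∀ z, v z ≤ 1 → ∃ c : k, v (z - algebraMap k L c) < 1)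
    {s : L} (hs : v s = exp (-1 : ℤ)) {x : L} (hx0 : x ≠ 0) (hx : v x < 1) (hDx : D x = x)
    (hbdd : ∃ N : ℕ, ∀ z, v z ≤ 1 → v (D z) ≤ exp (N : ℤ)) (z : L) : v (D z) ≤ v z := by
  have hs0 : s ≠ 0 := by
    rintro rfl
    rw [map_zero] at hs
    exact exp_ne_zero hs.symm
  have hnat (e : ℕ) (he : e ≠ 0) : v (e : L) = 1 := by
    have h1 := hk e
    have h2 := hk (e : k)⁻¹
    have h3 : algebraMap k L e * algebraMap k L (e : k)⁻¹ = 1 := by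
      rw [← map_mul, mul_inv_cancel₀ (by exact_mod_cast he), map_one]
    have h4 := congrArg v h3
    rw [map_mul, map_one] at h4
    rw [map_natCast] at h1 h4
    refine le_antisymm h1 ?_
    rw [← h4]
    exact mul_le_of_le_one_right' h2
  have hval (y : L) (hy : y ≠ 0) : ∃ (m : ℤ) (u : L), v u = 1 ∧ v y = exp m ∧ y = u * s ^ (-m) := by
    have hvy : v y ≠ 0 := by simpa using hy
    refine ⟨log (v y), y * s ^ (log (v y)), ?_, (exp_log hvy).symm, ?_⟩
    · rw [map_mul, map_zpow₀, hs, ← exp_zsmul]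
      conv_lhs => rw [← exp_log hvy]
      rw [← exp_add]
      simp
    · rw [mul_assoc, ← zpow_add₀ hs0]
      simp
  obtain ⟨m, u, hu, hxm, hxu⟩ := hval x hx0
  have hm : m < 0 := by
    rw [hxm, ← exp_zero] at hx
    exact exp_lt_exp.mp hx
  obtain ⟨e, rfl⟩ : ∃ e : ℕ, m = -e := ⟨m.natAbs, by omega⟩
  have he : e ≠ 0 := by omega
  rw [neg_neg, zpow_natCast] at hxu
  have hu0 : u ≠ 0 := by
    rintro rfl
    simp at hu
  have hDs : D s = (s * u - s * D u) * (e * u)⁻¹ := by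
    have h1 : D x = u * (e * (s ^ (e - 1) * D s)) + s ^ e * D u := by
      conv_lhs => rw [hxu]
      simp [Derivation.leibniz, Derivation.leibniz_pow]
    rw [hDx, hxu] at h1
    obtain ⟨e, rfl⟩ := Nat.exists_eq_succ_of_ne_zero he
    have he' : ((e + 1 : ℕ) : L) ≠ 0 := by
      intro h
      have := hnat _ he
      rw [h] at this
      simp at this
    have h2 : s ^ e ≠ 0 := pow_ne_zero _ hs0
    rw [eq_mul_inv_iff_mul_eq₀ (mul_ne_zero he' hu0)]
    apply mul_left_cancel₀ h2
    simp only [Nat.succ_eq_add_one, Nat.add_sub_cancel] at h1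
    linear_combination (-1 : L) * h1
  have hDs' (N : ℕ) (hN : ∀ z, v z ≤ 1 → v (D z) ≤ exp (N : ℤ)) :
      v (D s) ≤ exp ((N : ℤ) - 1) := by
    rw [hDs, map_mul, map_inv₀, map_mul, hnat e he, hu, mul_one, inv_one, mul_one]
    refine (v.map_sub _ _).trans (max_le ?_ ?_)
    · rw [map_mul, hs, hu, mul_one]
      exact exp_le_exp.mpr (by omega)
    · rw [map_mul, hs]
      refine (mul_le_mul_right (hN u hu.le) _).trans ?_
      rw [← exp_add]
      exact exp_le_exp.mpr (by omega)
  have hstep (N : ℕ) (hN : ∀ z, v z ≤ 1 → v (D z) ≤ exp ((N + 1 : ℕ) : ℤ)) :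
      ∀ z, v z ≤ 1 → v (D z) ≤ exp (N : ℤ) := by
    intro z hz
    obtain ⟨c, hc⟩ := hres z hz
    set w := z - algebraMap k L c with hw
    have hDw : D z = D w := by simp [hw]
    have hws : w = s * (w / s) := by field_simp
    have hv : v (w / s) ≤ 1 := by
      rcases eq_or_ne w 0 with h0 | h0
      · simp [h0]
      obtain ⟨m, u, -, hm, -⟩ := hval w h0
      rw [map_div₀, hm, hs, ← exp_sub, ← exp_zero]
      rw [hm, ← exp_zero, exp_lt_exp] at hc
      exact exp_le_exp.mpr (by omega)
    rw [hDw, hws, Derivation.leibniz]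
    simp only [smul_eq_mul]
    refine (v.map_add _ _).trans (max_le ?_ ?_)
    · rw [map_mul, hs]
      refine (mul_le_mul_right (hN _ hv) _).trans ?_
      rw [← exp_add]
      exact exp_le_exp.mpr (by push_cast; omega)
    · rw [map_mul]
      refine (mul_le_mul' hv (hDs' _ hN)).trans ?_
      rw [one_mul]
      exact exp_le_exp.mpr (by push_cast; omega)
  obtain ⟨N, hN⟩ := hbdd
  have h0 : ∀ z, v z ≤ 1 → v (D z) ≤ exp ((0 : ℕ) : ℤ) := by
    induction N with
    | zero => exact hN
    | succ N ih => exact ih (hstep N hN)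
  rcases eq_or_ne z 0 with rfl | hz
  · simp
  obtain ⟨m, u, hu, hzm, hzu⟩ := hval z hz
  rw [hzm, hzu, Derivation.leibniz, Derivation.leibniz_zpow]
  simp only [smul_eq_mul]
  have hint : v (((-m : ℤ) : L)) ≤ 1 := by
    have := hk ((-m : ℤ) : k)
    rwa [map_intCast] at this
  refine (v.map_add _ _).trans (max_le ?_ ?_)
  · rw [map_mul, hu, one_mul, zsmul_eq_mul, map_mul, map_mul, map_zpow₀, hs, ← exp_zsmul]
    refine (mul_le_mul' hint (mul_le_mul_right (hDs' 0 h0) _)).trans ?_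
    rw [← exp_add, one_mul]
    exact exp_le_exp.mpr (by simp)
  · rw [map_mul, map_zpow₀, hs, ← exp_zsmul]
    refine (mul_le_mul_right (h0 u hu.le) _).trans ?_
    rw [← exp_add]
    exact exp_le_exp.mpr (by simp)
end

section
variable {k L Γ : Type*} [Field k] [Field L] [Algebra k L] [LinearOrderedCommGroupWithZero Γ]
  (v : Valuation L Γ)

theorem Valuation.map_sub_mul_lt_one {a b c d : L} (ha : v a ≤ 1) (hd : v d ≤ 1)
    (hac : v (a - c) < 1) (hbd : v (b - d) < 1) : v (a * b - c * d) < 1 := by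
  have h : a * b - c * d = a * (b - d) + (a - c) * d := by ring
  rw [h]
  refine v.map_add_lt ?_ ?_ <;> rw [map_mul]
  · exact (mul_le_of_le_one_left' ha).trans_lt hbd
  · exact (mul_le_of_le_one_right' hd).trans_lt hac

theorem Valuation.le_one_of_sub_lt_one {a b : L} (hb : v b ≤ 1) (h : v (a - b) < 1) :
    v a ≤ 1 := by
  have : a = (a - b) + b := by ring
  rw [this]
  exact v.map_add_le h.le hb

theorem Valuation.map_algebraMap_eq_one {c : k} (hk : ∀ c : k, v (algebraMap k L c) ≤ 1)
    (hc : c ≠ 0) : v (algebraMap k L c) = 1 := by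
  have h4 : v (algebraMap k L c) * v (algebraMap k L c⁻¹) = 1 := by
    rw [← map_mul, ← map_mul, mul_inv_cancel₀ hc, map_one, map_one]
  refine le_antisymm (hk c) ?_
  rw [← h4]
  exact mul_le_of_le_one_right' (hk _)

theorem Valuation.map_sub_pow_lt_one {a c : L} (hc : v c ≤ 1)
    (hac : v (a - c) < 1) (n : ℕ) : v (a ^ n - c ^ n) < 1 := by
  have ha := v.le_one_of_sub_lt_one hc hac
  induction n with
  | zero => simp
  | succ n ih =>
    rw [pow_succ, pow_succ]
    refine v.map_sub_mul_lt_one ?_ hc ih hac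
    rw [map_pow]
    exact pow_le_one' ha n

/-- If `x` and `y` reduce to `a` and `c`, then `p(x)(y)` reduces to the value of `p` at `(a, c)`. -/
theorem Valuation.map_eval₂_sub_lt_one (hk : ∀ c : k, v (algebraMap k L c) ≤ 1)
    {x y : L} {a c : k}
    (hx : v (x - algebraMap k L a) < 1) (hy : v (y - algebraMap k L c) < 1) (p : k[X][X]) :
    v (p.eval₂ (eval₂RingHom (algebraMap k L) x) y -
      algebraMap k L ((p.map (evalRingHom a)).eval c)) < 1 := by
  have h1 (q : k[X]) : v (q.eval₂ (algebraMap k L) x - algebraMap k L (q.eval a)) < 1 := by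
    induction q using Polynomial.induction_on' with
    | add p q hp hq =>
      simp only [eval₂_add, eval_add, map_add]
      rw [add_sub_add_comm]
      exact v.map_add_lt hp hq
    | monomial n b =>
      simp only [eval₂_monomial, eval_monomial, map_mul, map_pow]
      refine v.map_sub_mul_lt_one (hk _) ?_ (by simp) (v.map_sub_pow_lt_one (hk _) hx n)
      rw [map_pow]
      exact pow_le_one' (hk _) n
  induction p using Polynomial.induction_on' with
  | add p q hp hq =>
    simp only [eval₂_add, Polynomial.map_add, eval_add, map_add]
    rw [add_sub_add_comm]
    exact v.map_add_lt hp hq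
  | monomial n b =>
    simp only [eval₂_monomial, Polynomial.map_monomial, eval_monomial, map_mul, map_pow,
      coe_eval₂RingHom, coe_evalRingHom]
    refine v.map_sub_mul_lt_one (v.le_one_of_sub_lt_one (hk _) (h1 b)) ?_ (h1 b)
      (v.map_sub_pow_lt_one (hk _) hy n)
    rw [map_pow]
    exact pow_le_one' (hk _) n

theorem Valuation.map_eval₂_le_one (hk : ∀ c : k, v (algebraMap k L c) ≤ 1)
    {x : L} (hx : v x ≤ 1) (q : k[X]) : v (q.eval₂ (algebraMap k L) x) ≤ 1 := by
  rw [eval₂_eq_sum_range]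
  refine v.map_sum_le fun i _ ↦ ?_
  rw [map_mul, map_pow]
  exact mul_le_one' (hk _) (pow_le_one' hx i)

/-- A root of a polynomial with integral coefficients and unit leading coefficient is integral. -/
theorem Valuation.le_one_of_eval₂_eq_zero {R : Type*} [CommRing R] (φ : R →+* L)
    (hφ : ∀ r, v (φ r) ≤ 1) {p : R[X]} (hp : v (φ p.leadingCoeff) = 1) {y : L}
    (hy : p.eval₂ φ y = 0) : v y ≤ 1 := by
  by_contra! hlt
  have h0 : v y ≠ 0 := (zero_lt_one.trans hlt).ne'
  rw [eval₂_eq_sum_range, Finset.sum_range_succ, add_eq_zero_iff_neg_eq] at hy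
  have h2 : v (φ (p.coeff p.natDegree) * y ^ p.natDegree) = v y ^ p.natDegree := by
    rw [map_mul, coeff_natDegree, hp, one_mul, map_pow]
  rw [← hy, Valuation.map_neg] at h2
  refine (v.map_sum_lt (g := v y ^ p.natDegree) (pow_ne_zero _ h0) fun i hi ↦ ?_).ne h2
  rw [map_mul, map_pow]
  refine (mul_le_of_le_one_left' (hφ _)).trans_lt ?_
  exact pow_lt_pow_right₀ hlt (Finset.mem_range.mp hi)

theorem Valuation.map_root_eq_one
    (hk : ∀ c : k, v (algebraMap k L c) ≤ 1)
    (hres : ∀ z, v z ≤ 1 → ∃ c : k, v (z - algebraMap k L c) < 1)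
    {x : L} {a : k} (hx : v (x - algebraMap k L a) < 1)
    {g : k[X][X]} (hlead : g.leadingCoeff.eval a ≠ 0) (hzero : (g.coeff 0).eval a ≠ 0)
    (hsimple : ∀ c, (g.map (evalRingHom a)).eval c = 0 →
      ((derivative g).map (evalRingHom a)).eval c ≠ 0)
    {y : L}
    (hy : g.eval₂ (eval₂RingHom (algebraMap k L) x) y = 0) :
    v y = 1 ∧ v ((derivative g).eval₂ (eval₂RingHom (algebraMap k L) x) y) = 1 := by
  have hx1 := v.le_one_of_sub_lt_one (hk a) hx
  have hunit {z : L} {c : k} (hc : c ≠ 0) (h : v (z - algebraMap k L c) < 1) : v z = 1 := by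
    have h1 := v.map_algebraMap_eq_one hk hc
    rw [← h1]
    exact v.map_eq_of_sub_lt (h1 ▸ h)
  have hlead' : v (eval₂RingHom (algebraMap k L) x g.leadingCoeff) = 1 := by
    have := v.map_eval₂_sub_lt_one hk hx (y := 0) (c := 0) (by simp) (C g.leadingCoeff)
    simp only [eval₂_C, map_C, eval_C, coe_evalRingHom] at this
    exact hunit hlead this
  have hy1 : v y ≤ 1 := v.le_one_of_eval₂_eq_zero _ (v.map_eval₂_le_one hk hx1) hlead' hy
  obtain ⟨c, hc⟩ := hres y hy1
  have hgc : (g.map (evalRingHom a)).eval c = 0 := by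
    have := v.map_eval₂_sub_lt_one hk hx hc g
    rw [hy, zero_sub, Valuation.map_neg] at this
    by_contra h
    exact this.ne (v.map_algebraMap_eq_one hk h)
  refine ⟨hunit ?_ hc, hunit (hsimple c hgc) (v.map_eval₂_sub_lt_one hk hx hc _)⟩
  rintro rfl
  rw [← coeff_zero_eq_eval_zero, coeff_map] at hgc
  exact hzero hgc

theorem Derivation.map_eval₂_sub_le_one (D : Derivation k L L)
    (hk : ∀ c : k, v (algebraMap k L c) ≤ 1) {x y : L} (hx : v x ≤ 1) (hy : v y ≤ 1)
    (hDx : v (D x) ≤ 1) (p : k[X][X]) :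
    v (D (p.eval₂ (eval₂RingHom (algebraMap k L) x) y) -
      (derivative p).eval₂ (eval₂RingHom (algebraMap k L) x) y * D y) ≤ 1 := by
  induction p using Polynomial.induction_on' with
  | add p q hp hq =>
    simp only [eval₂_add, map_add, add_mul]
    rw [add_sub_add_comm]
    exact v.map_add_le hp hq
  | monomial n b =>
    have h1 : D ((monomial n b).eval₂ (eval₂RingHom (algebraMap k L) x) y) -
      (derivative (monomial n b)).eval₂ (eval₂RingHom (algebraMap k L) x) y * D y =
        y ^ n * ((derivative b).eval₂ (algebraMap k L) x * D x) := by
      have h2 : D (b.eval₂ (algebraMap k L) x) = (derivative b).eval₂ (algebraMap k L) x * D x := by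
        rw [← aeval_def, ← aeval_def]
        rw [D.map_aeval, smul_eq_mul]
      simp only [eval₂_monomial, derivative_monomial, Derivation.leibniz, Derivation.leibniz_pow,
        coe_eval₂RingHom, h2, smul_eq_mul, nsmul_eq_mul, map_mul, eval₂_natCast]
      ring
    rw [h1, map_mul, map_mul, map_pow]
    exact mul_le_one' (pow_le_one' hy n) (mul_le_one' (v.map_eval₂_le_one hk hx _) hDx)

theorem Derivation.map_root_le_one
    (hk : ∀ c : k, v (algebraMap k L c) ≤ 1)
    (hres : ∀ z, v z ≤ 1 → ∃ c : k, v (z - algebraMap k L c) < 1)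
    {x : L} {a : k} (hx : v (x - algebraMap k L a) < 1)
    {g : k[X][X]} (hlead : g.leadingCoeff.eval a ≠ 0) (hzero : (g.coeff 0).eval a ≠ 0)
    (hsimple : ∀ c, (g.map (evalRingHom a)).eval c = 0 →
      ((derivative g).map (evalRingHom a)).eval c ≠ 0)
    (D : Derivation k L L) (hDx : v (D x) ≤ 1) {y : L}
    (hy : g.eval₂ (eval₂RingHom (algebraMap k L) x) y = 0) : v (D y) ≤ 1 := by
  obtain ⟨h1, h2⟩ := v.map_root_eq_one hk hres hx hlead hzero hsimple hy
  have h3 := D.map_eval₂_sub_le_one v hk (v.le_one_of_sub_lt_one (hk a) hx) h1.le hDx g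
  rwa [hy, map_zero, zero_sub, Valuation.map_neg, map_mul, h2, one_mul] at h3

theorem Valuation.map_sub_root_eq_one
    (hk : ∀ c : k, v (algebraMap k L c) ≤ 1)
    (hres : ∀ z, v z ≤ 1 → ∃ c : k, v (z - algebraMap k L c) < 1)
    {x : L} {a : k} (hx : v (x - algebraMap k L a) < 1)
    {g : k[X][X]} (hlead : g.leadingCoeff.eval a ≠ 0) (hzero : (g.coeff 0).eval a ≠ 0)
    (hsimple : ∀ c, (g.map (evalRingHom a)).eval c = 0 →
      ((derivative g).map (evalRingHom a)).eval c ≠ 0)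
    {y y' : L}
    (hy : g.eval₂ (eval₂RingHom (algebraMap k L) x) y = 0)
    (hy' : g.eval₂ (eval₂RingHom (algebraMap k L) x) y' = 0) (hne : y ≠ y') : v (y' - y) = 1 := by
  have hx1 := v.le_one_of_sub_lt_one (hk a) hx
  obtain ⟨h1, h2⟩ := v.map_root_eq_one hk hres hx hlead hzero hsimple hy
  obtain ⟨h1', -⟩ := v.map_root_eq_one hk hres hx hlead hzero hsimple hy'
  let φ : k[X] →+* v.integer :=
    (eval₂RingHom (algebraMap k L) x).codRestrict v.integer (v.map_eval₂_le_one hk hx1)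
  have hev (p : k[X][X]) (z : v.integer) : (((p.map φ).eval z : v.integer) : L) =
      p.eval₂ (eval₂RingHom (algebraMap k L) x) z := by
    rw [eval_map, ← v.integer.subtype_apply, hom_eval₂]
    rfl
  obtain ⟨q, hq⟩ := (g.map φ).binomExpansion ⟨y, h1.le⟩ (⟨y', h1'.le⟩ - ⟨y, h1.le⟩)
  have hq' := congrArg (fun z : v.integer ↦ (z : L)) hq
  rw [add_sub_cancel] at hq'
  simp only [Subring.coe_add, Subring.coe_mul, derivative_map, AddSubgroupClass.coe_sub,
    Subring.coe_pow, hev, hy, hy'] at hq'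
  have hd : y' - y ≠ 0 := sub_ne_zero.mpr hne.symm
  have h3 : (derivative g).eval₂ (eval₂RingHom (algebraMap k L) x) y = - (q * (y' - y)) := by
    apply mul_right_cancel₀ hd
    linear_combination - hq'
  refine le_antisymm (v.map_sub_le h1'.le h1.le) ?_
  rw [h3, Valuation.map_neg, map_mul] at h2
  rw [← h2]
  exact mul_le_of_le_one_left' q.2
end

section

theorem IsAlgClosed.exists_algebraMap_eq_of_isIntegral {k E : Type*} [Field k] [IsAlgClosed k]
    [CommRing E] [IsDomain E] [Algebra k E] {e : E} (he : IsIntegral k e) :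
    ∃ c : k, algebraMap k E c = e := by
  obtain ⟨c, hc⟩ := (IsAlgClosed.algebraMap_bijective_of_isIntegral (k := k)
    (K := integralClosure k E)).2 ⟨e, he⟩
  exact ⟨c, congrArg Subtype.val hc⟩

variable {k L : Type*} [Field k] [Field L] [Algebra k L] {x : L}

theorem Algebra.aeval_adjoin_singleton_surjective (x : L) :
    Function.Surjective (Polynomial.aeval (R := k)
      (⟨x, Algebra.self_mem_adjoin_singleton k x⟩ : Algebra.adjoin k {x})) := by
  rintro ⟨y, hy⟩
  have hy' := hy
  rw [Algebra.adjoin_singleton_eq_range_aeval] at hy'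
  obtain ⟨p, hp⟩ := hy'
  refine ⟨p, Subtype.ext ?_⟩
  refine Eq.trans ?_ hp
  simp

/-- Every residue field of an integral extension of `k[x]` at a nonzero prime is `k`. -/
theorem Ideal.exists_sub_algebraMap_mem [IsAlgClosed k]
    {O : Type*} [CommRing O] [IsDomain O] [Algebra k O] [Algebra (Algebra.adjoin k {x}) O]
    [IsScalarTower k (Algebra.adjoin k {x}) O] [Algebra.IsIntegral (Algebra.adjoin k {x}) O]
    (P : Ideal O) [P.IsPrime] (hP : P ≠ ⊥) (z : O) : ∃ c : k, z - algebraMap k O c ∈ P := by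
  suffices ∃ c : k, algebraMap k (O ⧸ P) c = Ideal.Quotient.mk P z by
    obtain ⟨c, hc⟩ := this
    refine ⟨c, ?_⟩
    rw [← Ideal.Quotient.eq, ← hc]
    rfl
  apply IsAlgClosed.exists_algebraMap_eq_of_isIntegral
  set A := Algebra.adjoin k {x} with hA
  have hbot := Ideal.IsIntegral.comap_ne_bot A hP
  obtain ⟨b, hbP, hb0⟩ := Submodule.exists_mem_ne_zero_of_ne_bot hbot
  obtain ⟨p, rfl⟩ := Algebra.aeval_adjoin_singleton_surjective x b
  let π : A →ₐ[k] O ⧸ P := (Ideal.Quotient.mkₐ k P).comp (IsScalarTower.toAlgHom k A O)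
  have hx : ∃ c : k, algebraMap k (O ⧸ P) c =
      π ⟨x, Algebra.self_mem_adjoin_singleton k x⟩ := by
    apply IsAlgClosed.exists_algebraMap_eq_of_isIntegral
    refine IsAlgebraic.isIntegral ⟨p, ?_, ?_⟩
    · rintro rfl
      simp at hb0
    · rw [aeval_algHom_apply]
      exact Ideal.Quotient.eq_zero_iff_mem.mpr hbP
  obtain ⟨c, hc⟩ := hx
  obtain ⟨q, hq, hqz⟩ := Algebra.IsIntegral.isIntegral (R := A) z
  have hlift : q.map (π : A →+* O ⧸ P) ∈ lifts (algebraMap k (O ⧸ P)) := by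
    rw [lifts_iff_coeff_lifts]
    intro n
    obtain ⟨r, hr⟩ := Algebra.aeval_adjoin_singleton_surjective x (q.coeff n)
    refine ⟨r.eval c, ?_⟩
    rw [coeff_map, ← hr, RingHom.coe_coe, ← aeval_algHom_apply, ← hc, aeval_algebraMap_apply]
    rfl
  obtain ⟨q', hq', -, hmonic⟩ := lifts_and_natDegree_eq_and_monic hlift (hq.map _)
  refine ⟨q', hmonic, ?_⟩
  rw [← eval_map, hq', eval_map]
  have := congrArg (Ideal.Quotient.mk P) hqz
  rw [map_zero, hom_eval₂] at this
  exact this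
end

section
open scoped IntermediateField IntermediateField.algebraAdjoinAdjoin WithZero
open WithZero

/-- A derivation has bounded poles on a finite algebra over `k[x]`. -/
theorem Valuation.exists_derivation_le_exp {k L : Type*} [Field k] [Field L] [Algebra k L] {x : L}
    (v : Valuation L ℤᵐ⁰) (D : Derivation k L L) (hk : ∀ c : k, v (algebraMap k L c) ≤ 1)
    (hx : v x ≤ 1) (hDx : v (D x) ≤ 1) (O : Subalgebra (Algebra.adjoin k {x}) L)
    [hfin : Module.Finite (Algebra.adjoin k {x}) O] (hO : ∀ y ∈ O, v y ≤ 1) :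
    ∃ N : ℕ, ∀ y ∈ O, v (D y) ≤ exp (N : ℤ) := by
  obtain ⟨S, hS⟩ := (Module.Finite.iff_fg (N := O.toSubmodule)).mp hfin
  have h1 (e : L) : ∃ N : ℕ, v (D e) ≤ exp (N : ℤ) := by
    by_cases h : v (D e) = 0
    · exact ⟨0, by simp [h]⟩
    refine ⟨(log (v (D e))).toNat, ?_⟩
    conv_lhs => rw [← exp_log h]
    exact exp_le_exp.mpr (Int.self_le_toNat _)
  choose f hf using h1
  refine ⟨S.sup f, fun y hyO ↦ ?_⟩
  have hy : y ∈ Submodule.span (Algebra.adjoin k {x}) (S : Set L) := hS ▸ hyO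
  clear hyO
  induction hy using Submodule.span_induction with
  | mem e he => exact (hf e).trans (exp_le_exp.mpr (by exact_mod_cast Finset.le_sup he))
  | zero => simp
  | add y y' _ _ h h' =>
    rw [map_add]
    exact v.map_add_le h h'
  | smul b y hy h =>
    have hyO : v y ≤ 1 := hO y (hS ▸ hy : y ∈ O.toSubmodule)
    obtain ⟨p, hp⟩ := Algebra.aeval_adjoin_singleton_surjective x b
    have hb (q : k[X]) : v (aeval x q) ≤ 1 := v.map_eval₂_le_one hk hx q
    have h1 : b • y = aeval x p * y := by
      rw [Algebra.smul_def, ← hp]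
      congr 1
      change (Algebra.adjoin k {x}).val _ = _
      rw [← aeval_algHom_apply]
      rfl
    rw [h1, Derivation.leibniz, D.map_aeval]
    simp only [smul_eq_mul]
    refine v.map_add_le ?_ ?_
    · rw [map_mul]
      exact (mul_le_of_le_one_left' (hb p)).trans h
    · rw [map_mul, map_mul]
      refine (mul_le_one' hyO (mul_le_one' (hb _) hDx)).trans ?_
      rw [← exp_zero]
      exact exp_le_exp.mpr (by omega)

theorem isIntegral_div_of_forall_valuation {k L : Type*} [Field k] [IsAlgClosed k] [CharZero k]
    [Field L] [Algebra k L] {x : L} (hx0 : x ≠ 0) [FiniteDimensional k⟮x⟯ L]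
    (D : Derivation k L L) (hDx : D x = x) {z : L}
    (hz : ∀ (v : Valuation L ℤᵐ⁰) (a : k), a ≠ 0 → (∀ c : k, v (algebraMap k L c) ≤ 1) →
      (∀ z, v z ≤ 1 → ∃ c : k, v (z - algebraMap k L c) < 1) →
      v (x - algebraMap k L a) < 1 → v (D z) ≤ v z) :
    IsIntegral (Algebra.adjoin k {x}) (D z / z) := by
  let A := Algebra.adjoin k {x}
  have : CharZero k⟮x⟯ := charZero_of_injective_algebraMap (algebraMap k k⟮x⟯).injective
  have : IsPrincipalIdealRing A :=
    IsPrincipalIdealRing.of_surjective _ (Algebra.aeval_adjoin_singleton_surjective x)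
  let O := integralClosure A L
  have : IsDedekindDomain O := integralClosure.isDedekindDomain A k⟮x⟯ L
  have : IsFractionRing O L := IsIntegralClosure.isFractionRing_of_finite_extension A k⟮x⟯ L O
  have : Module.Finite A O := IsIntegralClosure.finite A k⟮x⟯ L O
  suffices D z / z ∈ (algebraMap O L).range by
    obtain ⟨y, hy⟩ := this
    rw [← hy]
    exact y.2
  apply IsDedekindDomain.HeightOneSpectrum.mem_integers_of_valuation_le_one
  intro P
  have hk (c : k) : P.valuation L (algebraMap k L c) ≤ 1 :=
    P.valuation_le_one (K := L) (algebraMap k O c)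
  have hresO (y : O) : ∃ c : k, P.valuation L ((y : L) - algebraMap k L c) < 1 := by
    obtain ⟨c, hc⟩ := Ideal.exists_sub_algebraMap_mem (k := k) (x := x) P.asIdeal P.ne_bot y
    exact ⟨c, (P.valuation_lt_one_iff_mem (K := L) _).mpr hc⟩
  have hres (y : L) (hy : P.valuation L y ≤ 1) : ∃ c : k,
      P.valuation L (y - algebraMap k L c) < 1 := by
    obtain ⟨b, hb⟩ := P.exists_valuation_sub_lt_of_integer hy 1
    obtain ⟨c, hc⟩ := hresO b
    refine ⟨c, ?_⟩
    have h : y - algebraMap k L c = (b - algebraMap k L c) - (b - y) := by ring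
    rw [h]
    exact (P.valuation L).map_sub_lt hc hb
  suffices P.valuation L (D z) ≤ P.valuation L z by
    rw [map_div₀]
    exact div_le_one_of_le₀ this zero_le
  obtain ⟨a, ha⟩ := hresO ⟨x, isIntegral_algebraMap
    (x := (⟨x, Algebra.self_mem_adjoin_singleton k x⟩ : A))⟩
  by_cases ha0 : a = 0
  · rw [ha0, map_zero, sub_zero] at ha
    obtain ⟨s, hs⟩ := P.valuation_exists_uniformizer L
    refine (P.valuation L).map_derivation_le D hk hres hs hx0 ha hDx ?_ z
    obtain ⟨N, hNO⟩ := (P.valuation L).exists_derivation_le_exp D hk ha.le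
      (hDx.symm ▸ ha.le) O (fun y hy ↦ P.valuation_le_one (K := L) ⟨y, hy⟩)
    refine ⟨N, fun y hy ↦ ?_⟩
    obtain ⟨n, d, hnd⟩ := P.exists_primeCompl_mul_eq_of_integer y hy
    have hd : P.valuation L (algebraMap O L d) = 1 :=
      P.valuation_eq_one_iff_notMem.mpr d.2
    have h1 : D y * algebraMap O L d = D n - y * D (algebraMap O L d) := by
      rw [eq_sub_iff_add_eq]
      have := congrArg D hnd
      rw [Derivation.leibniz] at this
      simp only [smul_eq_mul] at this
      refine Eq.trans ?_ this
      ring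
    have h2 := congrArg (P.valuation L) h1
    rw [map_mul, hd, mul_one] at h2
    rw [h2]
    refine (P.valuation L).map_sub_le (hNO n n.2) ?_
    rw [map_mul]
    exact (mul_le_of_le_one_left' hy).trans (hNO _ (d : O).2)
  · exact hz _ a ha0 hk hres ha
end

section
open scoped IntermediateField

/-- The constants of a function field over `k` are the elements regular at all places. -/
theorem IsAlgClosed.exists_algebraMap_eq_of_isIntegral_adjoin {k L : Type*} [Field k]
    [IsAlgClosed k] [Field L] [Algebra k L] {x z : L} (h : IsIntegral (Algebra.adjoin k {x}) z)
    (h' : IsIntegral (Algebra.adjoin k {x⁻¹}) z) : ∃ c : k, algebraMap k L c = z := by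
  apply IsAlgClosed.exists_algebraMap_eq_of_isIntegral
  by_contra hz
  have hclosed : IsIntegrallyClosedIn (integralClosure k L).toSubring L :=
    inferInstanceAs (IsIntegrallyClosedIn (integralClosure k L) L)
  obtain ⟨V, hV, hzV⟩ := Subring.exists_le_valuationSubring_of_isIntegrallyClosedIn
    (R := (integralClosure k L).toSubring) (x := z) hz
  have key (y : L) (hy : y ∈ V) (hi : IsIntegral (Algebra.adjoin k {y}) z) : z ∈ V := by
    obtain ⟨p, hp, hpz⟩ := hi
    have hle (b : Algebra.adjoin k {y}) : (b : L) ∈ V := by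
      let W : Subalgebra k L :=
        { V.toSubring with
          algebraMap_mem' := fun c ↦ hV ((integralClosure k L).algebraMap_mem c) }
      have : Algebra.adjoin k {y} ≤ W := Algebra.adjoin_le (Set.singleton_subset_iff.mpr hy)
      exact this b.2
    let φ : Algebra.adjoin k {y} →+* V :=
      (Algebra.adjoin k {y}).val.toRingHom.codRestrict V hle
    have hi : IsIntegral V z := ⟨p.map φ, hp.map φ, by rw [eval₂_map]; exact hpz⟩
    obtain ⟨w, hw⟩ := IsIntegrallyClosed.isIntegral_iff.mp hi
    rw [← hw]
    exact w.2
  exact hzV ((V.mem_or_inv_mem x).elim (key x · h) (key x⁻¹ · h'))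

theorem Derivation.exists_eq_algebraMap_mul {k L : Type*} [Field k] [IsAlgClosed k] [CharZero k]
    [Field L] [Algebra k L] {x : L} (hx0 : x ≠ 0) [FiniteDimensional k⟮x⟯ L]
    (D : Derivation k L L) (hDx : D x = x) {z : L} (hz0 : z ≠ 0)
    (hz : ∀ (v : Valuation L (WithZero (Multiplicative ℤ))) (a : k), a ≠ 0 →
      (∀ c : k, v (algebraMap k L c) ≤ 1) →
      (∀ z, v z ≤ 1 → ∃ c : k, v (z - algebraMap k L c) < 1) →
      v (x - algebraMap k L a) < 1 → v (D z) ≤ v z) :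
    ∃ c : k, D z = algebraMap k L c * z := by
  have h1 := isIntegral_div_of_forall_valuation hx0 D hDx hz
  have hadj : k⟮x⁻¹⟯ = k⟮x⟯ := by
    apply le_antisymm <;> rw [IntermediateField.adjoin_simple_le_iff]
    · exact inv_mem (IntermediateField.mem_adjoin_simple_self k x)
    · simpa using inv_mem (IntermediateField.mem_adjoin_simple_self k x⁻¹)
  have : FiniteDimensional k⟮x⁻¹⟯ L := by rw [hadj]; assumption
  have hD : (-D) x⁻¹ = x⁻¹ := by
    rw [Derivation.neg_apply, Derivation.leibniz_inv, hDx]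
    simp [field]
  have h2 : IsIntegral (Algebra.adjoin k {x⁻¹}) ((-D) z / z) := by
    refine isIntegral_div_of_forall_valuation (inv_ne_zero hx0) (-D) hD ?_
    intro v a ha hk hres hx
    rw [Derivation.neg_apply, Valuation.map_neg]
    refine hz v a⁻¹ (inv_ne_zero ha) hk hres ?_
    have ha1 := v.map_algebraMap_eq_one hk ha
    have hx1 : v x⁻¹ = 1 := by rw [← ha1]; exact v.map_eq_of_sub_lt (ha1.symm ▸ hx)
    have ha0 : algebraMap k L a ≠ 0 := by simpa using ha
    have : x - algebraMap k L a⁻¹ = -(x⁻¹ - algebraMap k L a) * x * (algebraMap k L a)⁻¹ := by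
      rw [map_inv₀]
      field_simp
      ring
    rw [this, map_mul, map_mul, map_inv₀ v, ha1, Valuation.map_neg]
    rw [map_inv₀, inv_eq_one] at hx1
    simpa [hx1] using hx
  rw [Derivation.neg_apply, neg_div] at h2
  obtain ⟨c, hc⟩ := IsAlgClosed.exists_algebraMap_eq_of_isIntegral_adjoin h1
    (by simpa using h2.neg)
  exact ⟨c, by rw [hc, div_mul_cancel₀ _ hz0]⟩

/-- If `g` specializes to a polynomial of full degree with simple nonzero roots at each `a ≠ 0`,
then all roots of `g` are eigenvectors of `x d/dx` for a common eigenvalue. -/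
theorem Derivation.exists_forall_root_eq_algebraMap_mul {k L : Type*} [Field k] [IsAlgClosed k]
    [CharZero k] [Field L] [Algebra k L] {x : L} (hx0 : x ≠ 0) [FiniteDimensional k⟮x⟯ L]
    (D : Derivation k L L) (hDx : D x = x) {g : k[X][X]}
    (hlead : ∀ a, a ≠ 0 → g.leadingCoeff.eval a ≠ 0) (hzero : ∀ a, a ≠ 0 → (g.coeff 0).eval a ≠ 0)
    (hsimple : ∀ a, a ≠ 0 → ∀ c, (g.map (evalRingHom a)).eval c = 0 →
      ((derivative g).map (evalRingHom a)).eval c ≠ 0)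
    (hg0 : (g.coeff 0).eval₂ (algebraMap k L) x ≠ 0) :
    ∃ c : k, ∀ y : L, g.eval₂ (eval₂RingHom (algebraMap k L) x) y = 0 →
      D y = algebraMap k L c * y := by
  have hne {y : L} (hy : g.eval₂ (eval₂RingHom (algebraMap k L) x) y = 0) : y ≠ 0 := by
    rintro rfl
    rw [eval₂_at_zero] at hy
    exact hg0 hy
  have hDx' {Γ : Type _} [LinearOrderedCommGroupWithZero Γ] {v : Valuation L Γ} {a : k}
      (hk : ∀ c : k, v (algebraMap k L c) ≤ 1) (hx : v (x - algebraMap k L a) < 1) :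
      v (D x) ≤ 1 := by
    rw [hDx]
    exact v.le_one_of_sub_lt_one (hk a) hx
  have hroot (y : L) (hy : g.eval₂ (eval₂RingHom (algebraMap k L) x) y = 0) :
      ∃ c : k, D y = algebraMap k L c * y := by
    refine D.exists_eq_algebraMap_mul hx0 hDx (hne hy) fun v a ha hk hres hx ↦ ?_
    rw [(v.map_root_eq_one hk hres hx (hlead a ha) (hzero a ha) (hsimple a ha) hy).1]
    exact Derivation.map_root_le_one v hk hres hx (hlead a ha) (hzero a ha) (hsimple a ha) D
      (hDx' hk hx) hy
  by_cases hex : ∃ y : L, g.eval₂ (eval₂RingHom (algebraMap k L) x) y = 0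
  swap
  · exact ⟨0, fun y hy ↦ (hex ⟨y, hy⟩).elim⟩
  obtain ⟨y₁, hy₁⟩ := hex
  obtain ⟨c₁, hc₁⟩ := hroot y₁ hy₁
  refine ⟨c₁, fun y hy ↦ ?_⟩
  by_cases hyy : y = y₁
  · rw [hyy, hc₁]
  obtain ⟨c₂, hc₂⟩ := hroot y hy
  obtain ⟨c, hc⟩ : ∃ c : k, D (y₁ - y) = algebraMap k L c * (y₁ - y) := by
    refine D.exists_eq_algebraMap_mul hx0 hDx (sub_ne_zero.mpr (Ne.symm hyy))
      fun v a ha hk hres hx ↦ ?_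
    rw [v.map_sub_root_eq_one hk hres hx (hlead a ha) (hzero a ha) (hsimple a ha) hy hy₁ hyy,
      map_sub]
    exact v.map_sub_le
      (Derivation.map_root_le_one v hk hres hx (hlead a ha) (hzero a ha) (hsimple a ha) D
        (hDx' hk hx) hy₁)
      (Derivation.map_root_le_one v hk hres hx (hlead a ha) (hzero a ha) (hsimple a ha) D
        (hDx' hk hx) hy)
  rw [map_sub, hc₁, hc₂] at hc
  by_contra hcon
  have hc12 : c₁ ≠ c₂ := by
    rintro rfl
    exact hcon hc₂
  have h1 : algebraMap k L (c₁ - c) * y₁ = algebraMap k L (c₂ - c) * y := by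
    rw [map_sub, map_sub]
    linear_combination hc
  have h2 := congrArg D h1
  rw [Derivation.leibniz, Derivation.leibniz, D.map_algebraMap, D.map_algebraMap] at h2
  simp only [smul_eq_mul, mul_zero, add_zero, hc₁, hc₂] at h2
  have h3 : algebraMap k L ((c₁ - c₂) * (c₂ - c)) * y = 0 := by
    simp only [map_sub, map_mul] at h1 h2 ⊢
    linear_combination h2 - algebraMap k L c₁ * h1
  have h4 : c₂ = c := by
    simpa [hne hy, sub_eq_zero, hc12] using h3
  rw [h4, sub_self, map_zero, zero_mul] at h1
  have h5 : c₁ = c := by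
    simpa [hne hy₁, sub_eq_zero] using h1
  exact hc12 (h5.trans h4.symm)
end

theorem Derivation.exists_extension_of_formallyEtale {R S T : Type*} [CommRing R] [CommRing S]
    [CommRing T] [Algebra R S] [Algebra R T] [Algebra S T] [IsScalarTower R S T]
    [Algebra.FormallyEtale S T] (d : Derivation R S T) :
    ∃ D : Derivation R T T, ∀ s, D (algebraMap S T s) = d s := by
  have h := KaehlerDifferential.isBaseChange_of_formallyEtale R S T
  refine ⟨(h.lift d.liftKaehlerDifferential).compDer (KaehlerDifferential.D R T), fun s ↦ ?_⟩
  have h1 := h.lift_eq d.liftKaehlerDifferential (KaehlerDifferential.D R S s)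
  rw [KaehlerDifferential.map_D, Derivation.liftKaehlerDifferential_comp_D] at h1
  exact h1

theorem Derivation.coeff_prod_X_sub_C {k L : Type*} [Field k] [Field L] [Algebra k L]
    (D : Derivation k L L) {c : L} (s : Multiset L) (hs : ∀ y ∈ s, D y = c * y)
    (j : ℕ) : D ((s.map fun y ↦ X - C y).prod.coeff j) =
      (s.card - j) * c * (s.map fun y ↦ X - C y).prod.coeff j := by
  induction s using Multiset.induction_on generalizing j with
  | empty => by_cases hj : j = 0 <;> simp [coeff_one, hj]
  | cons y s ih =>
    have ih' := ih fun z hz ↦ hs z (Multiset.mem_cons_of_mem hz)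
    have hy := hs y (Multiset.mem_cons_self y s)
    rw [Multiset.map_cons, Multiset.prod_cons, Multiset.card_cons, sub_mul]
    cases j with
    | zero =>
      simp only [coeff_sub, coeff_X_mul_zero, coeff_C_mul, map_sub, map_zero, Derivation.leibniz,
        ih', hy, smul_eq_mul]
      push_cast
      ring
    | succ j =>
      simp only [coeff_sub, coeff_X_mul, coeff_C_mul, map_sub, Derivation.leibniz,
        ih', hy, smul_eq_mul]
      push_cast
      ring

section
open scoped IntermediateField

theorem exists_weight_of_forall_simple_root {k : Type*} [Field k] [IsAlgClosed k]
    [CharZero k] {g : k[X][X]} {b : k} {m : ℕ} (hb : b ≠ 0) (hgm : g.leadingCoeff = C b * X ^ m)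
    (hg0 : g.coeff 0 ≠ 0) (hzero : ∀ a, a ≠ 0 → (g.coeff 0).eval a ≠ 0)
    (hsimple : ∀ a, a ≠ 0 → ∀ c, (g.map (evalRingHom a)).eval c = 0 →
      ((derivative g).map (evalRingHom a)).eval c ≠ 0) :
    ∃ c : k, ∀ i j : ℕ, (g.coeff j).coeff i ≠ 0 → (i : k) = m + (g.natDegree - j) * c := by
  let F := FractionRing k[X]
  let L := (g.map (algebraMap k[X] F)).SplittingField
  have : CharZero F := charZero_of_injective_algebraMap (algebraMap k F).injective
  have : CharZero L := charZero_of_injective_algebraMap (algebraMap k L).injective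
  have hinj : Function.Injective (algebraMap k[X] L) := by
    rw [IsScalarTower.algebraMap_eq k[X] F L]
    exact (algebraMap F L).injective.comp (IsFractionRing.injective k[X] F)
  have : Algebra.FormallyEtale k[X] F := .of_isLocalization (nonZeroDivisors k[X])
  have : Algebra.FormallyEtale F L := Algebra.FormallyEtale.of_isSeparable F L
  have : Algebra.FormallyEtale k[X] L := .comp k[X] F L
  let x : L := algebraMap k[X] L X
  have hx0 : x ≠ 0 := by simpa [x] using hinj.ne X_ne_zero
  have : IsScalarTower k k[X] L := IsScalarTower.of_algebraMap_eq fun r ↦ by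
    rw [IsScalarTower.algebraMap_apply k F L, IsScalarTower.algebraMap_apply k[X] F L,
      ← IsScalarTower.algebraMap_apply k k[X] F]
  obtain ⟨D, hD⟩ := (mkDerivation k x).exists_extension_of_formallyEtale (T := L)
  have hDx : D x = x := by rw [hD, mkDerivation_X]
  have haeval (p : k[X]) : p.eval₂ (algebraMap k L) x = algebraMap k[X] L p :=
    (aeval_algebraMap_apply L X p).trans (by rw [aeval_X_left_apply])
  have hφ : eval₂RingHom (algebraMap k L) x = algebraMap k[X] L := RingHom.ext haeval
  have hfin : FiniteDimensional k⟮x⟯ L := by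
    have hmem (z : F) : algebraMap F L z ∈ k⟮x⟯ := by
      have h (p : k[X]) : algebraMap F L (algebraMap k[X] F p) ∈ k⟮x⟯ := by
        rw [← IsScalarTower.algebraMap_apply, ← haeval, eval₂_eq_sum_range]
        exact sum_mem fun i _ ↦ mul_mem (k⟮x⟯.algebraMap_mem _)
          (pow_mem (IntermediateField.mem_adjoin_simple_self k x) i)
      obtain ⟨p, q, -, rfl⟩ := IsFractionRing.div_surjective (A := k[X]) z
      rw [map_div₀]
      exact div_mem (h p) (h q)
    algebraize [(algebraMap F L).codRestrict k⟮x⟯ hmem]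
    have : IsScalarTower F k⟮x⟯ L := IsScalarTower.of_algebraMap_eq fun _ ↦ rfl
    exact Module.Finite.of_restrictScalars_finite F k⟮x⟯ L
  obtain ⟨c, hc⟩ := D.exists_forall_root_eq_algebraMap_mul hx0 hDx (g := g)
    (fun a ha ↦ by simp [hgm, hb, ha]) hzero hsimple (by rw [haeval]; simpa using hinj.ne hg0)
  rw [hφ] at hc
  refine ⟨c, fun i j hij ↦ ?_⟩
  set G := g.map (algebraMap k[X] L) with hG
  have hsplit : G.Splits := by
    have := SplittingField.splits (g.map (algebraMap k[X] F))
    rwa [map_map, ← IsScalarTower.algebraMap_eq] at this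
  have hprod := hsplit.eq_prod_roots
  have hcard : G.roots.card = g.natDegree := by
    rw [← hsplit.natDegree_eq_card_roots, natDegree_map_eq_of_injective hinj]
  have hroots : ∀ y ∈ G.roots, D y = algebraMap k L c * y := by
    intro y hy
    apply hc
    rw [← eval_map]
    exact isRoot_of_mem_roots hy
  have hlead : G.leadingCoeff = algebraMap k L b * x ^ m := by
    rw [leadingCoeff_map_of_injective hinj, hgm, ← haeval]
    simp
  have hcoeff : algebraMap k[X] L (g.coeff j) =
      G.leadingCoeff * (G.roots.map fun y ↦ X - C y).prod.coeff j := by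
    rw [← coeff_C_mul, ← hprod, coeff_map]
  have hDG : D (algebraMap k[X] L (g.coeff j)) =
      algebraMap k L (m + (g.natDegree - j) * c) * algebraMap k[X] L (g.coeff j) := by
    rw [hcoeff, Derivation.leibniz, D.coeff_prod_X_sub_C _ hroots, hlead,
      Derivation.leibniz, Derivation.leibniz_pow, hDx, D.map_algebraMap, hcard]
    have hxm : (m : L) * (x ^ (m - 1) * x) = m * x ^ m := by
      rcases m with _ | m
      · simp
      · simp [pow_succ]
    simp only [smul_eq_mul, nsmul_eq_mul, map_add, map_mul, map_sub, map_natCast]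
    linear_combination (algebraMap k L b) * (G.roots.map fun y ↦ X - C y).prod.coeff j * hxm
  have hpoly : X * derivative (g.coeff j) = C (m + (g.natDegree - j) * c) * g.coeff j := by
    apply hinj
    rw [map_mul, map_mul, ← haeval (C _), eval₂_C, ← hDG, hD, mkDerivation_apply]
    rw [Algebra.smul_def, mul_comm]
  have hi := congrArg (fun p ↦ p.coeff i) hpoly
  rw [coeff_C_mul] at hi
  apply mul_right_cancel₀ hij
  rw [← hi]
  cases i with
  | zero => simp
  | succ i =>
    rw [coeff_X_mul, coeff_derivative]
    push_cast
    ring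
end

section
open scoped nonZeroDivisors

theorem Squarefree.map_fractionRing {R F : Type*} [CommRing R] [IsDomain R]
    [UniqueFactorizationMonoid R] [Field F] [Algebra R F] [IsFractionRing R F] {f : R[X]}
    (hf : Squarefree f) (hf0 : f ≠ 0) : Squarefree (f.map (algebraMap R F)) := by
  let : NormalizedGCDMonoid R := Nonempty.some inferInstance
  intro p hp
  have hp0 : p ≠ 0 := by
    rintro rfl
    rw [mul_zero, zero_dvd_iff, Polynomial.map_eq_zero_iff (IsFractionRing.injective R F)] at hp
    exact hf0 hp
  apply isUnit_or_eq_zero_of_isUnit_integerNormalization_primPart (R := R) hp0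
  apply hf
  have hprim := (IsLocalization.integerNormalization R⁰ p).isPrimitive_primPart
  apply (hprim.mul hprim).dvd_of_fraction_map_dvd_fraction_map (K := F)
  obtain ⟨b, hb, hbp⟩ := IsLocalization.integerNormalization_spec R⁰ p
  have hb0 : algebraMap R F b ≠ 0 := by
    simpa using nonZeroDivisors.ne_zero hb
  have hdvd : (IsLocalization.integerNormalization R⁰ p).primPart.map (algebraMap R F) ∣ p := by
    have h := Polynomial.map_dvd (algebraMap R F)
      (IsLocalization.integerNormalization R⁰ p).primPart_dvd
    rw [hbp, ← algebraMap_smul F b p, smul_eq_C_mul] at h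
    exact ((isUnit_C.mpr hb0.isUnit).dvd_mul_left).mp h
  rw [Polynomial.map_mul]
  exact (mul_dvd_mul hdvd hdvd).trans hp

theorem exists_mul_add_mul_eq_C_of_isCoprime_map {R F : Type*} [CommRing R] [IsDomain R]
    [Field F] [Algebra R F] [IsFractionRing R F] {p q : R[X]}
    (h : IsCoprime (p.map (algebraMap R F)) (q.map (algebraMap R F))) :
    ∃ (u v : R[X]) (d : R), d ≠ 0 ∧ u * p + v * q = C d := by
  obtain ⟨u, v, huv⟩ := h
  obtain ⟨b, hb, hbu⟩ := IsLocalization.integerNormalization_spec R⁰ u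
  obtain ⟨c, hc, hcv⟩ := IsLocalization.integerNormalization_spec R⁰ v
  rw [← algebraMap_smul F, smul_eq_C_mul] at hbu hcv
  refine ⟨C c * IsLocalization.integerNormalization R⁰ u,
    C b * IsLocalization.integerNormalization R⁰ v, b * c,
    mul_ne_zero (nonZeroDivisors.ne_zero hb) (nonZeroDivisors.ne_zero hc), ?_⟩
  apply map_injective (algebraMap R F) (IsFractionRing.injective R F)
  simp only [Polynomial.map_add, Polynomial.map_mul, map_C, hbu, hcv, map_mul]
  linear_combination C (algebraMap R F b) * C (algebraMap R F c) * huv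
end

theorem IsAlgClosed.exists_zpow_eq {k : Type*} [Field k] [IsAlgClosed k] {c : k} (hc : c ≠ 0)
    {α : ℤ} (hα : α ≠ 0) : ∃ t : k, t ≠ 0 ∧ t ^ α = c := by
  have hpos : 0 < α.natAbs := Int.natAbs_pos.mpr hα
  obtain ⟨t, ht⟩ := IsAlgClosed.exists_pow_nat_eq c hpos
  have ht0 : t ≠ 0 := by
    rintro rfl
    exact hc (by rw [← ht, zero_pow hpos.ne'])
  rcases Int.natAbs_eq α with h | h
  · exact ⟨t, ht0, by rw [h, zpow_natCast, ht]⟩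
  · exact ⟨t⁻¹, inv_ne_zero ht0, by rw [h, zpow_neg, inv_zpow, inv_inv, zpow_natCast, ht]⟩

theorem eval_map_evalRingHom_zpow_mul {k : Type*} [Field k] {g : k[X][X]} {w α β : ℤ}
    (hg : ∀ i j : ℕ, (g.coeff j).coeff i ≠ 0 → α * (i : ℤ) + β * (j : ℤ) = w) {t : k} (ht : t ≠ 0)
    (a b : k) : (g.map (evalRingHom (t ^ α * a))).eval (t ^ β * b) =
      t ^ w * (g.map (evalRingHom a)).eval b := by
  simp only [eval_map, eval₂_eq_sum_range, coe_evalRingHom]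
  simp only [eval_eq_sum_range, Finset.sum_mul, Finset.mul_sum]
  refine Finset.sum_congr rfl fun j _ ↦ Finset.sum_congr rfl fun i _ ↦ ?_
  by_cases hij : (g.coeff j).coeff i = 0
  · simp [hij]
  · rw [← hg i j hij, zpow_add₀ ht, zpow_mul, zpow_mul, mul_pow, mul_pow, zpow_natCast,
      zpow_natCast]
    ring

/-- A quasi-homogeneous polynomial whose discriminant does not vanish identically has only simple
roots over every nonzero point. -/
theorem eval_derivative_ne_zero_of_quasiHomogeneous {k : Type*} [Field k] [IsAlgClosed k]
    {g u v : k[X][X]} {d : k[X]} (hd : d ≠ 0) (huv : u * g + v * derivative g = C d)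
    {w α β : ℤ} (hα : α ≠ 0)
    (hg : ∀ i j : ℕ, (g.coeff j).coeff i ≠ 0 → α * (i : ℤ) + β * (j : ℤ) = w)
    {a b : k} (ha : a ≠ 0) (hb : (g.map (evalRingHom a)).eval b = 0) :
    ((derivative g).map (evalRingHom a)).eval b ≠ 0 := by
  intro hb'
  have hg' : ∀ i j : ℕ, ((derivative g).coeff j).coeff i ≠ 0 →
      α * (i : ℤ) + β * (j : ℤ) = w - β := by
    intro i j hij
    have : (g.coeff (j + 1)).coeff i ≠ 0 := by
      intro h
      apply hij
      rw [coeff_derivative, ← Nat.cast_succ, mul_comm, ← nsmul_eq_mul, coeff_smul, h, smul_zero]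
    have := hg i (j + 1) this
    push_cast at this
    linear_combination this
  obtain ⟨s, hs⟩ := (d * X).exists_eval_ne_zero_of_natDegree_lt_card
    (mul_ne_zero hd X_ne_zero) ((Cardinal.natCast_lt_aleph0).trans_le (Cardinal.aleph0_le_mk k))
  rw [eval_mul, eval_X] at hs
  obtain ⟨t, ht, hts⟩ := IsAlgClosed.exists_zpow_eq
    (div_ne_zero (right_ne_zero_of_mul hs) ha) hα
  have hta : t ^ α * a = s := by rw [hts, div_mul_cancel₀ _ ha]
  have h1 := eval_map_evalRingHom_zpow_mul hg ht a b
  have h2 := eval_map_evalRingHom_zpow_mul hg' ht a b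
  rw [hb, mul_zero, hta] at h1
  rw [hb', mul_zero, hta] at h2
  have h3 := congrArg (fun p : k[X][X] ↦ (p.map (evalRingHom s)).eval (t ^ β * b)) huv
  simp only [Polynomial.map_add, Polynomial.map_mul, eval_add, eval_mul, h1, h2, mul_zero,
    add_zero, map_C, eval_C, coe_evalRingHom] at h3
  exact left_ne_zero_of_mul hs h3.symm

theorem isNonzeroMonomial_of_forall_coeff {K : Type*} [Field K] {p : K[X]} (hp : p ≠ 0)
    (h : ∀ i i' : ℕ, p.coeff i ≠ 0 → p.coeff i' ≠ 0 → i = i') : IsNonzeroMonomial p := by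
  have hlead : p.coeff p.natDegree ≠ 0 := leadingCoeff_ne_zero.mpr hp
  refine ⟨p.coeff p.natDegree, p.natDegree, hlead, ?_⟩
  ext i
  rw [coeff_C_mul_X_pow]
  split_ifs with hi
  · rw [hi]
  · by_contra hne
    exact hi (h _ _ hne hlead)

theorem weight_eq_of_slope_eq {k : Type*} [Field k] [CharZero k] {i j i₀ m n : ℕ} {γ : k}
    (h₀ : (i₀ : k) = m + n * γ) (h : (i : k) = m + (n - j) * γ) :
    (n : ℤ) * i + (i₀ - m) * j = n * i₀ := by
  have h1 : ((n * i + (i₀ - m) * j : ℤ) : k) = ((n * i₀ : ℤ) : k) := by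
    push_cast
    linear_combination (n : k) * h - (n - j : k) * h₀
  exact_mod_cast h1

/-- The main theorem over an arbitrary field `K` of characteristic `0`:
for a reduced (squarefree) bivariate polynomial `f = Σ_{i=0}^n f_i(x) y^i ∈ K[x][y]`
with `f₀ ≠ 0` and `f_n ≠ 0`, quasi-homogeneity with nonzero weight of `x` is
equivalent to `f₀`, `f_n` being nonzero monomials and, for every nonzero `a` in the
algebraic closure `K̄`, the polynomial `f(a, y) ∈ K̄[y]` having degree `n` and no
repeated root in `K̄`. -/
theorem quasiHomogeneous_iff_char_zero
    (K : Type*) [Field K] [CharZero K]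
    (f : Polynomial (Polynomial K)) (n : ℕ) (hn : n = f.natDegree)
    (hsf : Squarefree f) (h0 : f.coeff 0 ≠ 0) (hN : f.coeff n ≠ 0) :
    (∃ w α β : ℤ, α ≠ 0 ∧
        ∀ i j : ℕ, (f.coeff j).coeff i ≠ 0 → α * (i : ℤ) + β * (j : ℤ) = w) ↔
      (IsNonzeroMonomial (f.coeff 0) ∧ IsNonzeroMonomial (f.coeff n) ∧
        ∀ a : AlgebraicClosure K, a ≠ 0 →
          ((f.map (mapRingHom (algebraMap K (AlgebraicClosure K)))).map
              (evalRingHom a)).natDegree = n ∧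
            ∀ b : AlgebraicClosure K,
              ((f.map (mapRingHom (algebraMap K (AlgebraicClosure K)))).map
                (evalRingHom a)).rootMultiplicity b ≤ 1) := by
  set k := AlgebraicClosure K
  have hinj : Function.Injective (algebraMap K k) := (algebraMap K k).injective
  have hφ : Function.Injective (mapRingHom (algebraMap K k)) := map_injective _ hinj
  set g := f.map (mapRingHom (algebraMap K k)) with hg
  have hgdeg : g.natDegree = n := by rw [hn, natDegree_map_eq_of_injective hφ]
  have hgcoeff (i j : ℕ) : (g.coeff j).coeff i = algebraMap K k ((f.coeff j).coeff i) := by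
    rw [coeff_map, coe_mapRingHom, coeff_map]
  have hgsupp (i j : ℕ) : (g.coeff j).coeff i ≠ 0 ↔ (f.coeff j).coeff i ≠ 0 := by
    rw [hgcoeff, _root_.map_ne_zero]
  have heval {j : ℕ} (h : IsNonzeroMonomial (f.coeff j)) {a : k} (ha : a ≠ 0) :
      (g.coeff j).eval a ≠ 0 := by
    obtain ⟨c, m, hc, hcm⟩ := h
    simp [hg, hcm, hc, ha]
  have hne (h : IsNonzeroMonomial (f.coeff 0)) {a : k} (ha : a ≠ 0) :
      g.map (evalRingHom a) ≠ 0 := by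
    intro h1
    apply heval h ha
    rw [← coe_evalRingHom, ← coeff_map, h1, coeff_zero]
  constructor
  · rintro ⟨w, α, β, hα, hw⟩
    have hmon {j : ℕ} (hj : f.coeff j ≠ 0) : IsNonzeroMonomial (f.coeff j) := by
      refine isNonzeroMonomial_of_forall_coeff hj fun i i' hi hi' ↦ ?_
      have h1 : α * (i : ℤ) = α * i' := by linear_combination hw i j hi - hw i' j hi'
      exact_mod_cast mul_left_cancel₀ hα h1
    refine ⟨hmon h0, hmon hN, fun a ha ↦ ⟨?_, fun b ↦ ?_⟩⟩
    · rw [natDegree_map_of_leadingCoeff_ne_zero, hgdeg]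
      rw [← coeff_natDegree, hgdeg]
      exact heval (hmon hN) ha
    · by_contra! hb
      rw [one_lt_rootMultiplicity_iff_isRoot (hne (hmon h0) ha), derivative_map] at hb
      have hf0 : f ≠ 0 := hsf.ne_zero
      let F := FractionRing K[X]
      have : CharZero F := charZero_of_injective_algebraMap (algebraMap K F).injective
      have hsep := PerfectField.separable_iff_squarefree.mpr (hsf.map_fractionRing (F := F) hf0)
      rw [separable_def, derivative_map] at hsep
      obtain ⟨u, v, d, hd, huv⟩ := exists_mul_add_mul_eq_C_of_isCoprime_map hsep
      have huv' := congrArg (Polynomial.map (mapRingHom (algebraMap K k))) huv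
      rw [Polynomial.map_add, Polynomial.map_mul, Polynomial.map_mul, ← derivative_map,
        map_C] at huv'
      exact eval_derivative_ne_zero_of_quasiHomogeneous (by simpa using hφ.ne hd) huv' hα
        (fun i j hij ↦ hw i j ((hgsupp i j).mp hij)) ha hb.1 hb.2
  · rintro ⟨hm0, hmn, hB⟩
    have hsimple (a : k) (ha : a ≠ 0) (c : k) (hc : (g.map (evalRingHom a)).eval c = 0) :
        ((derivative g).map (evalRingHom a)).eval c ≠ 0 := by
      intro hc'
      have := (hB a ha).2 c
      rw [← not_lt, one_lt_rootMultiplicity_iff_isRoot (hne hm0 ha), derivative_map] at this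
      exact this ⟨hc, hc'⟩
    obtain ⟨b, m, hb, hbm⟩ := hmn
    have hgm : g.leadingCoeff = C (algebraMap K k b) * X ^ m := by
      rw [← coeff_natDegree, hgdeg, coeff_map, hbm]
      simp
    obtain ⟨γ, hγ⟩ := exists_weight_of_forall_simple_root (by simpa using hb) hgm
      (by rw [coeff_map]; simpa using hφ.ne h0) (fun a ha ↦ heval hm0 ha) hsimple
    rw [hgdeg] at hγ
    obtain ⟨c, i₀, hc, hci⟩ := hm0
    have hsupp0 (i : ℕ) (hi : (f.coeff 0).coeff i ≠ 0) : i = i₀ := by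
      by_contra h
      simp [hci, coeff_X_pow, h] at hi
    by_cases hn0 : n = 0
    · refine ⟨i₀, 1, 0, one_ne_zero, fun i j hij ↦ ?_⟩
      have hj : j = 0 := by
        by_contra hj
        rw [coeff_eq_zero_of_natDegree_lt (p := f) (by omega)] at hij
        exact hij rfl
      rw [hj] at hij
      simp [hsupp0 i hij]
    · refine ⟨n * i₀, n, i₀ - m, by exact_mod_cast hn0, fun i j hij ↦ ?_⟩
      have h1 := hγ i₀ 0 (by rw [hgsupp, hci]; simpa using hc)
      have h2 := hγ i j ((hgsupp i j).mpr hij)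
      have : CharZero k := charZero_of_injective_algebraMap hinj
      exact weight_eq_of_slope_eq (by simpa using h1) h2
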